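/- Let ε ≥ 0 and let ρ₀, ρ₁ be positive definite density matrices in M_n(ℂ). Under the standing assumptions (σ-detailed balance and ergodicity of L), relaxing the invertibility constraint on the connecting curve does not change the transport distance: W_ε²(ρ₀,ρ₁) = inf{ ∫₀¹ ⟨V(t), [ρ(t)]_ω⁻¹ V(t)⟩ dt : (ρ,V) ∈ CE'_ε(ρ₀,ρ₁) }, where CE'_ε allows the curve ρ(t) to be merely positive semidefinite (with trace one) instead of positive definite. -/

import Mathlib

open MeasureTheory Matrix
open scoped ENNReal Classical ComplexOrder

/-- Normalized trace `τ(A) = Tr(A)/n` on `M_n(ℂ)`. -/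
noncomputable def tau {N : Type*} [Fintype N] (A : Matrix N N ℂ) : ℂ :=
  A.trace / (Fintype.card N)

/-- GNS inner product `⟨A,B⟩ = τ(A* B)`, conjugate-linear in the first argument. -/
noncomputable def gns {N : Type*} [Fintype N] (A B : Matrix N N ℂ) : ℂ := tau (Aᴴ * B)

/-- Fractional power `X^s` of a positive semidefinite matrix via functional calculus
(junk value `0` if `X` is not hermitian). -/
noncomputable def mpow {N : Type*} [Fintype N] [DecidableEq N] (X : Matrix N N ℂ) (s : ℝ) :
    Matrix N N ℂ :=
  if hX : X.IsHermitian then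
    (Matrix.IsHermitian.eigenvectorUnitary hX : Matrix N N ℂ) *
      Matrix.diagonal (fun i => ((hX.eigenvalues i ^ s : ℝ) : ℂ)) *
      (star (Matrix.IsHermitian.eigenvectorUnitary hX : Matrix N N ℂ))
  else 0

/-- The operator `[X]_α(A) = ∫₀¹ e^{α(s-1/2)} X^s A X^{1-s} ds` on `M_n(ℂ)`. -/
noncomputable def sandwich {N : Type*} [Fintype N] [DecidableEq N] (X : Matrix N N ℂ) (α : ℝ)
    (A : Matrix N N ℂ) : Matrix N N ℂ :=
  Matrix.of fun i k =>
    ∫ s in (0:ℝ)..1, Real.exp (α * (s - 1/2)) • ((mpow X s * A * mpow X (1 - s)) i k)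

section H

variable {N : Type*} [Fintype N] [DecidableEq N] {J : Type*} [Fintype J]

/-- Inner product on `H = ⊕_{j ∈ J} M_n(ℂ)`. -/
noncomputable def gnsH (V W : J → Matrix N N ℂ) : ℂ := ∑ j, gns (V j) (W j)

/-- The operator `[ρ]_ω = ⊕_j [ρ]_{ω_j}` on `H`. -/
noncomputable def opOmega (ω : J → ℝ) (ρ : Matrix N N ℂ) (W : J → Matrix N N ℂ) :
    J → Matrix N N ℂ :=
  fun j => sandwich ρ (ω j) (W j)

/-- Extended value `⟨V, K⁻¹ V⟩ ∈ [0,∞]`: equals `⟨W, K W⟩` if `V = K W` with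
`W ⊥ ker K`, and `∞` if `V ∉ ran K`. -/
noncomputable def invQuadH (K : (J → Matrix N N ℂ) → (J → Matrix N N ℂ))
    (V : J → Matrix N N ℂ) : ℝ≥0∞ :=
  if h : ∃ W, K W = V ∧ ∀ U, K U = 0 → gnsH W U = 0
  then ENNReal.ofReal (gnsH h.choose (K h.choose)).re
  else ⊤

/-- The partial derivative `∂_j A = [V_j, A]`; `gradD V A = ∇A`. -/
noncomputable def gradD (Vf : J → Matrix N N ℂ) (A : Matrix N N ℂ) : J → Matrix N N ℂ :=
  fun j => Vf j * A - A * Vf j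

/-- The Lindblad generator `L(A) = ∑_j (e^{-ω_j/2} V_j^*[A,V_j] - e^{ω_j/2}[A,V_j]V_j^*)`. -/
noncomputable def genL (Vf : J → Matrix N N ℂ) (ω : J → ℝ) (A : Matrix N N ℂ) :
    Matrix N N ℂ :=
  ∑ j, (Real.exp (-ω j / 2) • ((Vf j)ᴴ * (A * Vf j - Vf j * A)) -
        Real.exp (ω j / 2) • ((A * Vf j - Vf j * A) * (Vf j)ᴴ))

/-- Membership in `CE_ε(ρ₀,ρ₁)`: `ρ` is a C¹ curve of invertible density matrices joining
`ρ₀` to `ρ₁`, `Vc` is continuous, and the continuity equation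
`ρ'(t) + div Vc(t) = ε L†ρ(t)` holds on `[0,1]`. -/
def IsCE (dvg : (J → Matrix N N ℂ) → Matrix N N ℂ) (Ldag : Matrix N N ℂ → Matrix N N ℂ)
    (ε : ℝ) (ρ₀ ρ₁ : Matrix N N ℂ) (ρ : ℝ → Matrix N N ℂ) (Vc : ℝ → J → Matrix N N ℂ) :
    Prop :=
  ρ 0 = ρ₀ ∧ ρ 1 = ρ₁ ∧
  (∀ t ∈ Set.Icc (0:ℝ) 1, (ρ t).PosDef ∧ tau (ρ t) = 1) ∧
  (∀ j i k, ContinuousOn (fun t => Vc t j i k) (Set.Icc (0:ℝ) 1)) ∧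
  ∃ ρ' : ℝ → Matrix N N ℂ,
    (∀ t ∈ Set.Icc (0:ℝ) 1, ∀ i k, HasDerivAt (fun s => ρ s i k) (ρ' t i k) t) ∧
    (∀ i k, ContinuousOn (fun t => ρ' t i k) (Set.Icc (0:ℝ) 1)) ∧
    (∀ t ∈ Set.Icc (0:ℝ) 1, ρ' t + dvg (Vc t) = ε • Ldag (ρ t))

/-- The squared entropic transport distance `W_ε²(ρ₀,ρ₁)`. -/
noncomputable def Wsq (ω : J → ℝ) (dvg : (J → Matrix N N ℂ) → Matrix N N ℂ)
    (Ldag : Matrix N N ℂ → Matrix N N ℂ) (ε : ℝ) (ρ₀ ρ₁ : Matrix N N ℂ) : ℝ≥0∞ :=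
  ⨅ (ρ : ℝ → Matrix N N ℂ) (Vc : ℝ → J → Matrix N N ℂ)
    (_ : IsCE dvg Ldag ε ρ₀ ρ₁ ρ Vc),
      ∫⁻ t in Set.Icc (0:ℝ) 1, invQuadH (opOmega ω (ρ t)) (Vc t)

/-- Hamilton–Jacobi–Bellmann subsolutions: `A` is a C¹ curve of hermitian matrices with
`τ((Ȧ(t) + ε L A(t))ρ) + ½⟨∇A(t), [ρ]_ω ∇A(t)⟩ ≤ 0` for all `t ∈ [0,1]` and all
density matrices `ρ`.  (`A'` records the derivative of `A`.) -/
noncomputable def IsHJB (Vf : J → Matrix N N ℂ) (ω : J → ℝ) (ε : ℝ)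
    (A A' : ℝ → Matrix N N ℂ) : Prop :=
  (∀ t ∈ Set.Icc (0:ℝ) 1, (A t).IsHermitian) ∧
  (∀ t ∈ Set.Icc (0:ℝ) 1, ∀ i k, HasDerivAt (fun s => A s i k) (A' t i k) t) ∧
  (∀ i k, ContinuousOn (fun t => A' t i k) (Set.Icc (0:ℝ) 1)) ∧
  ∀ t ∈ Set.Icc (0:ℝ) 1, ∀ ρ : Matrix N N ℂ, ρ.PosSemidef → tau ρ = 1 →
    (tau ((A' t + ε • genL Vf ω (A t)) * ρ)).re
      + (1/2) * (gnsH (gradD Vf (A t)) (opOmega ω ρ (gradD Vf (A t)))).re ≤ 0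

end H

/-- Membership in the relaxed class `CE'_ε(ρ₀,ρ₁)`: identical to `CE_ε(ρ₀,ρ₁)` except that
the curve `ρ(t)` is only required to be a positive semidefinite density matrix. -/
def IsCE' {N : Type*} [Fintype N] [DecidableEq N] {J : Type*} [Fintype J]
    (dvg : (J → Matrix N N ℂ) → Matrix N N ℂ) (Ldag : Matrix N N ℂ → Matrix N N ℂ)
    (ε : ℝ) (ρ₀ ρ₁ : Matrix N N ℂ) (ρ : ℝ → Matrix N N ℂ) (Vc : ℝ → J → Matrix N N ℂ) :
    Prop :=
  ρ 0 = ρ₀ ∧ ρ 1 = ρ₁ ∧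
  (∀ t ∈ Set.Icc (0:ℝ) 1, (ρ t).PosSemidef ∧ tau (ρ t) = 1) ∧
  (∀ j i k, ContinuousOn (fun t => Vc t j i k) (Set.Icc (0:ℝ) 1)) ∧
  ∃ ρ' : ℝ → Matrix N N ℂ,
    (∀ t ∈ Set.Icc (0:ℝ) 1, ∀ i k, HasDerivAt (fun s => ρ s i k) (ρ' t i k) t) ∧
    (∀ i k, ContinuousOn (fun t => ρ' t i k) (Set.Icc (0:ℝ) 1)) ∧
    (∀ t ∈ Set.Icc (0:ℝ) 1, ρ' t + dvg (Vc t) = ε • Ldag (ρ t))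

section mpow

variable {N : Type*} [Fintype N] [DecidableEq N]

theorem mpow_eq_cfc {X : Matrix N N ℂ} (hX : X.IsHermitian) (s : ℝ) :
    mpow X s = cfc (fun x : ℝ => x ^ s) X := by
  rw [hX.cfc_eq, mpow, dif_pos hX, Matrix.IsHermitian.cfc, Unitary.conjStarAlgAut_apply]
  rfl

open scoped MatrixOrder Matrix.Norms.L2Operator in
theorem mpow_eq_rpow {X : Matrix N N ℂ} (hX : X.PosSemidef) (s : ℝ) : mpow X s = X ^ s := by
  rw [mpow_eq_cfc hX.1, CFC.rpow_eq_cfc_real hX.nonneg]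

theorem mpow_posSemidef {X : Matrix N N ℂ} (hX : X.PosSemidef) (s : ℝ) :
    (mpow X s).PosSemidef := by
  open scoped MatrixOrder Matrix.Norms.L2Operator in
  rw [mpow_eq_rpow hX, ← Matrix.nonneg_iff_posSemidef]
  exact CFC.rpow_nonneg

/-- Löwner–Heinz: fractional powers with exponent in `[0,1]` are operator monotone. -/
theorem mpow_sub_posSemidef {X Y : Matrix N N ℂ} (hX : X.PosSemidef) (hY : Y.PosSemidef)
    (h : (X - Y).PosSemidef) {s : ℝ} (hs : s ∈ Set.Icc (0 : ℝ) 1) :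
    (mpow X s - mpow Y s).PosSemidef := by
  open scoped MatrixOrder Matrix.Norms.L2Operator in
  rw [mpow_eq_rpow hX, mpow_eq_rpow hY, ← Matrix.le_iff]
  exact CFC.rpow_le_rpow hs (Matrix.le_iff.2 h)

theorem mpow_smul {X : Matrix N N ℂ} (hX : X.PosSemidef) {c : ℝ} (hc : 0 ≤ c) (s : ℝ) :
    mpow (c • X) s = c ^ s • mpow X s := by
  have hXs : IsSelfAdjoint X := hX.1
  have hfin : (spectrum ℝ X).Finite := Matrix.finite_real_spectrum
  have hspec : ∀ x ∈ spectrum ℝ X, 0 ≤ x := by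
    intro x hx
    rw [hX.1.spectrum_real_eq_range_eigenvalues] at hx
    obtain ⟨i, rfl⟩ := hx
    exact hX.eigenvalues_nonneg i
  have hcX : (c • X).IsHermitian := hX.1.smul (IsSelfAdjoint.all c)
  rw [mpow_eq_cfc hcX, mpow_eq_cfc hX.1,
    ← cfc_comp_const_mul c (fun x : ℝ => x ^ s) X ((hfin.image _).continuousOn _) hXs,
    ← cfc_const_mul (c ^ s) (fun x : ℝ => x ^ s) X (hfin.continuousOn _)]
  exact cfc_congr fun x hx => Real.mul_rpow hc (hspec x hx)

theorem mpow_one_left (s : ℝ) : mpow (1 : Matrix N N ℂ) s = 1 := by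
  rw [mpow_eq_cfc Matrix.isHermitian_one, cfc_apply_one, Real.one_rpow, map_one]

theorem memLp_rpow_const {c : ℝ} (hc : 0 ≤ c) :
    MemLp (fun s : ℝ => c ^ s) ⊤ (volume.restrict (Set.Ioc (0 : ℝ) 1)) := by
  refine memLp_top_of_bound (Measurable.aestronglyMeasurable (by fun_prop)) (max c 1) ?_
  filter_upwards [ae_restrict_mem measurableSet_Ioc] with s hs
  rw [Real.norm_of_nonneg (Real.rpow_nonneg hc s)]
  calc c ^ s ≤ (max c 1) ^ s := Real.rpow_le_rpow hc (le_max_left _ _) hs.1.le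
    _ ≤ (max c 1) ^ (1 : ℝ) := Real.rpow_le_rpow_of_exponent_le (le_max_right _ _) hs.2
    _ = _ := Real.rpow_one _

theorem memLp_rpow_const_one_sub {c : ℝ} (hc : 0 ≤ c) :
    MemLp (fun s : ℝ => c ^ (1 - s)) ⊤ (volume.restrict (Set.Ioc (0 : ℝ) 1)) := by
  refine memLp_top_of_bound (Measurable.aestronglyMeasurable (by fun_prop)) (max c 1) ?_
  filter_upwards [ae_restrict_mem measurableSet_Ioc] with s hs
  rw [Real.norm_of_nonneg (Real.rpow_nonneg hc _)]
  calc c ^ (1 - s) ≤ (max c 1) ^ (1 - s) :=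
        Real.rpow_le_rpow hc (le_max_left _ _) (by linarith [hs.2])
    _ ≤ (max c 1) ^ (1 : ℝ) :=
        Real.rpow_le_rpow_of_exponent_le (le_max_right _ _) (by linarith [hs.1])
    _ = _ := Real.rpow_one _

theorem mpow_apply {X : Matrix N N ℂ} (hX : X.IsHermitian) (s : ℝ) (i k : N) :
    mpow X s i k = ∑ a, (hX.eigenvectorUnitary : Matrix N N ℂ) i a *
      ((hX.eigenvalues a ^ s : ℝ) : ℂ) * star ((hX.eigenvectorUnitary : Matrix N N ℂ) k a) := by
  rw [mpow, dif_pos hX, Matrix.mul_apply]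
  simp [Matrix.mul_diagonal]

theorem memLp_mpow {X : Matrix N N ℂ} (hX : X.PosSemidef) (i k : N) :
    MemLp (fun s : ℝ => mpow X s i k) ⊤ (volume.restrict (Set.Ioc (0 : ℝ) 1)) := by
  simp only [mpow_apply hX.1]
  exact memLp_finsetSum _ fun a _ =>
    ((memLp_rpow_const (hX.eigenvalues_nonneg a)).ofReal.const_mul _).mul_const _

theorem memLp_mpow_one_sub {X : Matrix N N ℂ} (hX : X.PosSemidef) (i k : N) :
    MemLp (fun s : ℝ => mpow X (1 - s) i k) ⊤ (volume.restrict (Set.Ioc (0 : ℝ) 1)) := by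
  simp only [mpow_apply hX.1]
  exact memLp_finsetSum _ fun a _ =>
    ((memLp_rpow_const_one_sub (hX.eigenvalues_nonneg a)).ofReal.const_mul _).mul_const _

theorem memLp_exp_mul (α : ℝ) :
    MemLp (fun s : ℝ => Real.exp (α * (s - 1 / 2))) ⊤ (volume.restrict (Set.Ioc (0 : ℝ) 1)) := by
  obtain ⟨C, hC⟩ := isCompact_Icc.exists_bound_of_continuousOn (s := Set.Icc (0 : ℝ) 1)
    (f := fun s : ℝ => Real.exp (α * (s - 1 / 2))) (by fun_prop)
  refine memLp_top_of_bound (Measurable.aestronglyMeasurable (by fun_prop)) C ?_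
  filter_upwards [ae_restrict_mem measurableSet_Ioc] with s hs
  exact hC s (Set.Ioc_subset_Icc_self hs)

theorem intervalIntegrable_sandwich {X : Matrix N N ℂ} (hX : X.PosSemidef) (α : ℝ)
    (A : Matrix N N ℂ) (i k : N) :
    IntervalIntegrable (fun s : ℝ => Real.exp (α * (s - 1 / 2)) •
      ((mpow X s * A * mpow X (1 - s)) i k)) volume 0 1 := by
  rw [intervalIntegrable_iff_integrableOn_Ioc_of_le zero_le_one]
  have h : MemLp (fun s : ℝ => (mpow X s * A * mpow X (1 - s)) i k) ⊤
      (volume.restrict (Set.Ioc (0 : ℝ) 1)) := by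
    simp only [Matrix.mul_apply]
    refine memLp_finsetSum _ fun b _ => MemLp.mul (p := ⊤) (q := ⊤)
      (memLp_mpow_one_sub hX b k) (memLp_finsetSum _ fun a _ => ?_)
    exact (memLp_mpow hX i a).mul_const _
  exact (MemLp.smul (p := ⊤) (q := ⊤) (r := ⊤) h (memLp_exp_mul α)).integrable le_top

end mpow

section gns

variable {N : Type*} [Fintype N]

theorem gns_eq_sum (A B : Matrix N N ℂ) :
    gns A B = (∑ i, ∑ k, star (A k i) * B k i) / (Fintype.card N) := by
  simp [gns, tau, Matrix.trace, Matrix.mul_apply]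

theorem gns_add_right (A B C : Matrix N N ℂ) : gns A (B + C) = gns A B + gns A C := by
  simp [gns, tau, Matrix.mul_add, add_div]

theorem gns_sub_right (A B C : Matrix N N ℂ) : gns A (B - C) = gns A B - gns A C := by
  simp [gns, tau, Matrix.mul_sub, sub_div]

theorem gns_smul_right (r : ℝ) (A B : Matrix N N ℂ) : gns A (r • B) = r • gns A B := by
  simp [gns, tau, mul_div_assoc]

theorem gns_add_left (A B C : Matrix N N ℂ) : gns (A + B) C = gns A C + gns B C := by
  simp [gns, tau, Matrix.add_mul, add_div]

theorem gns_smul_left (r : ℝ) (A B : Matrix N N ℂ) : gns (r • A) B = r • gns A B := by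
  simp [gns, tau, mul_div_assoc]

theorem star_gns (A B : Matrix N N ℂ) : star (gns A B) = gns B A := by
  simp only [gns, tau, star_div₀, ← Matrix.trace_conjTranspose, Matrix.conjTranspose_mul,
    Matrix.conjTranspose_conjTranspose, star_natCast]

theorem re_gns_comm (A B : Matrix N N ℂ) : (gns A B).re = (gns B A).re := by
  rw [← star_gns A B]
  rfl

theorem re_gns_self_nonneg (A : Matrix N N ℂ) : 0 ≤ (gns A A).re := by
  have h : (0 : ℂ) ≤ gns A A :=
    div_nonneg (Matrix.posSemidef_conjTranspose_mul_self A).trace_nonneg (Nat.cast_nonneg _)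
  exact (Complex.le_def.1 h).1

theorem eq_zero_of_re_gns_self [Nonempty N] {A : Matrix N N ℂ} (h : (gns A A).re = 0) : A = 0 := by
  have h0 : (0 : ℂ) ≤ (Aᴴ * A).trace := (Matrix.posSemidef_conjTranspose_mul_self A).trace_nonneg
  have hc : (Fintype.card N : ℝ) ≠ 0 := by exact_mod_cast Fintype.card_ne_zero
  rw [← Matrix.trace_conjTranspose_mul_self_eq_zero_iff]
  refine Complex.ext ?_ (Complex.le_def.1 h0).2.symm
  rw [gns, tau, Complex.div_natCast_re, div_eq_zero_iff] at h
  exact h.resolve_right hc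

theorem gns_left_ext [Nonempty N] {A B : Matrix N N ℂ} (h : ∀ C, gns A C = gns B C) : A = B := by
  rw [← sub_eq_zero]
  apply eq_zero_of_re_gns_self
  have hs : gns (A - B) (A - B) = gns A (A - B) - gns B (A - B) := by
    simp [gns, tau, Matrix.sub_mul, sub_div]
  rw [hs, h, sub_self, Complex.zero_re]

theorem re_gns_mul_mul_nonneg {P Q : Matrix N N ℂ} (hP : P.PosSemidef) (hQ : Q.PosSemidef)
    (W : Matrix N N ℂ) : 0 ≤ (gns W (P * W * Q)).re := by
  obtain ⟨B, rfl⟩ : ∃ B : Matrix N N ℂ, Q = Bᴴ * B := by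
    open scoped MatrixOrder Matrix.Norms.L2Operator in
    exact CStarAlgebra.nonneg_iff_eq_star_mul_self.1 hQ.nonneg
  have h : (Wᴴ * (P * W * (Bᴴ * B))).trace = ((W * Bᴴ)ᴴ * P * (W * Bᴴ)).trace := by
    rw [Matrix.conjTranspose_mul, Matrix.conjTranspose_conjTranspose,
      show Wᴴ * (P * W * (Bᴴ * B)) = (Wᴴ * P * W * Bᴴ) * B by simp only [Matrix.mul_assoc],
      Matrix.trace_mul_comm]
    simp only [Matrix.mul_assoc]
  have h0 : (0 : ℂ) ≤ gns W (P * W * (Bᴴ * B)) := by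
    rw [gns, tau, h]
    exact div_nonneg (hP.conjTranspose_mul_mul_same _).trace_nonneg (Nat.cast_nonneg _)
  exact (Complex.le_def.1 h0).1

theorem intervalIntegrable_gns {F : ℝ → Matrix N N ℂ} {a b : ℝ}
    (hF : ∀ i k, IntervalIntegrable (fun s => F s i k) volume a b) (W : Matrix N N ℂ) :
    IntervalIntegrable (fun s => gns W (F s)) volume a b := by
  simp only [gns_eq_sum]
  refine IntervalIntegrable.div_const ?_ _
  simp only [intervalIntegrable_iff, IntegrableOn] at hF ⊢
  exact integrable_finsetSum _ fun i _ => integrable_finsetSum _ fun k _ => (hF k i).const_mul _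

theorem gns_intervalIntegral {F : ℝ → Matrix N N ℂ} {a b : ℝ}
    (hF : ∀ i k, IntervalIntegrable (fun s => F s i k) volume a b) (W : Matrix N N ℂ) :
    gns W (Matrix.of fun i k => ∫ s in a..b, F s i k) = ∫ s in a..b, gns W (F s) := by
  have hI (k i : N) : IntervalIntegrable (fun s => star (W k i) * F s k i) volume a b :=
    (hF k i).const_mul _
  simp only [gns_eq_sum]
  rw [intervalIntegral.integral_div, intervalIntegral.integral_finsetSum]
  · congr 1
    refine Finset.sum_congr rfl fun i _ => ?_
    rw [intervalIntegral.integral_finsetSum fun k _ => hI k i]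
    refine Finset.sum_congr rfl fun k _ => ?_
    rw [intervalIntegral.integral_const_mul, Matrix.of_apply]
  · intro i _
    simp only [intervalIntegrable_iff, IntegrableOn] at hI ⊢
    exact integrable_finsetSum _ fun k _ => hI k i

theorem two_mul_re_gns_le (r : ℝ) (W U : Matrix N N ℂ) :
    2 * r * (gns W U).re ≤ r ^ 2 * (gns W W).re + (gns U U).re := by
  have h := re_gns_self_nonneg (r • W + (-1 : ℝ) • U)
  simp only [gns_add_left, gns_add_right, gns_smul_left, gns_smul_right, Complex.add_re,
    Complex.smul_re, smul_eq_mul, re_gns_comm U W] at h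
  linarith

end gns

section sandwich

variable {N : Type*} [Fintype N] [DecidableEq N]

theorem sandwich_add {X : Matrix N N ℂ} (hX : X.PosSemidef) (α : ℝ) (A B : Matrix N N ℂ) :
    sandwich X α (A + B) = sandwich X α A + sandwich X α B := by
  ext i k
  simp only [sandwich, Matrix.of_apply, Matrix.add_apply]
  rw [← intervalIntegral.integral_add (intervalIntegrable_sandwich hX α A i k)
    (intervalIntegrable_sandwich hX α B i k)]
  simp only [Matrix.mul_add, Matrix.add_mul, Matrix.add_apply, smul_add]

theorem sandwich_smul_right (X : Matrix N N ℂ) (α r : ℝ) (A : Matrix N N ℂ) :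
    sandwich X α (r • A) = r • sandwich X α A := by
  ext i k
  simp only [sandwich, Matrix.of_apply, Matrix.smul_apply]
  rw [← intervalIntegral.integral_smul]
  simp only [Matrix.mul_smul, Matrix.smul_mul, Matrix.smul_apply, smul_comm r]

theorem sandwich_smul_left {X : Matrix N N ℂ} (hX : X.PosSemidef) {c : ℝ} (hc : 0 < c) (α : ℝ)
    (A : Matrix N N ℂ) : sandwich (c • X) α A = c • sandwich X α A := by
  ext i k
  simp only [sandwich, Matrix.of_apply, Matrix.smul_apply]
  rw [← intervalIntegral.integral_smul]
  have h (s : ℝ) : mpow (c • X) s * A * mpow (c • X) (1 - s) =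
      c • (mpow X s * A * mpow X (1 - s)) := by
    rw [mpow_smul hX hc.le, mpow_smul hX hc.le, Matrix.smul_mul, Matrix.smul_mul, Matrix.mul_smul,
      smul_smul, ← Real.rpow_add hc]
    simp
  simp only [h, Matrix.smul_apply, smul_comm c]

theorem intervalIntegrable_re_gns_mul_mul {X : Matrix N N ℂ} (hX : X.PosSemidef) (α : ℝ)
    (W Z : Matrix N N ℂ) :
    IntervalIntegrable (fun s : ℝ => Real.exp (α * (s - 1 / 2)) *
      (gns W (mpow X s * Z * mpow X (1 - s))).re) volume 0 1 := by
  have h := intervalIntegrable_gns (F := fun s : ℝ => Real.exp (α * (s - 1 / 2)) •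
    (mpow X s * Z * mpow X (1 - s))) (intervalIntegrable_sandwich hX α Z) W
  rw [intervalIntegrable_iff] at h ⊢
  refine h.re.congr (ae_of_all _ fun s => ?_)
  simp only [gns_smul_right, Complex.real_smul, RCLike.re_to_complex, Complex.re_ofReal_mul]

theorem re_gns_sandwich {X : Matrix N N ℂ} (hX : X.PosSemidef) (α : ℝ) (W Z : Matrix N N ℂ) :
    (gns W (sandwich X α Z)).re = ∫ s in (0 : ℝ)..1, Real.exp (α * (s - 1 / 2)) *
      (gns W (mpow X s * Z * mpow X (1 - s))).re := by
  have hI := intervalIntegrable_sandwich hX α Z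
  have h : gns W (sandwich X α Z) = ∫ s in (0 : ℝ)..1, gns W (Real.exp (α * (s - 1 / 2)) •
      (mpow X s * Z * mpow X (1 - s))) := gns_intervalIntegral hI W
  have hintegral := intervalIntegrable_gns (F := fun s : ℝ => Real.exp (α * (s - 1 / 2)) •
    (mpow X s * Z * mpow X (1 - s))) hI W
  rw [h, ← Complex.reCLM_apply, ← ContinuousLinearMap.intervalIntegral_comp_comm _ hintegral]
  refine intervalIntegral.integral_congr fun s _ => ?_
  simp only [gns_smul_right, Complex.reCLM_apply, Complex.real_smul, Complex.re_ofReal_mul]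

theorem re_gns_sandwich_comm {X : Matrix N N ℂ} (hX : X.PosSemidef) (α : ℝ) (W Z : Matrix N N ℂ) :
    (gns W (sandwich X α Z)).re = (gns Z (sandwich X α W)).re := by
  rw [re_gns_sandwich hX, re_gns_sandwich hX]
  refine intervalIntegral.integral_congr fun s _ => ?_
  have h1 : (mpow X s)ᴴ = mpow X s := (mpow_posSemidef hX s).1
  have h2 : (mpow X (1 - s))ᴴ = mpow X (1 - s) := (mpow_posSemidef hX (1 - s)).1
  have h : gns (mpow X s * Z * mpow X (1 - s)) W = gns Z (mpow X s * W * mpow X (1 - s)) := by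
    simp only [gns, tau, Matrix.conjTranspose_mul, h1, h2]
    rw [Matrix.mul_assoc, Matrix.trace_mul_comm]
    simp only [Matrix.mul_assoc]
  simp only [re_gns_comm W, h]

theorem re_gns_sandwich_self_nonneg {X : Matrix N N ℂ} (hX : X.PosSemidef) (α : ℝ)
    (W : Matrix N N ℂ) : 0 ≤ (gns W (sandwich X α W)).re := by
  rw [re_gns_sandwich hX]
  exact intervalIntegral.integral_nonneg zero_le_one fun s _ => mul_nonneg (Real.exp_nonneg _)
    (re_gns_mul_mul_nonneg (mpow_posSemidef hX _) (mpow_posSemidef hX _) _)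

/-- The quadratic form of `[X]_α` is monotone in `X`. -/
theorem re_gns_sandwich_mono {X Y : Matrix N N ℂ} (hX : X.PosSemidef) (hY : Y.PosSemidef)
    (h : (X - Y).PosSemidef) (α : ℝ) (W : Matrix N N ℂ) :
    (gns W (sandwich Y α W)).re ≤ (gns W (sandwich X α W)).re := by
  rw [re_gns_sandwich hX, re_gns_sandwich hY]
  refine intervalIntegral.integral_mono_on zero_le_one (intervalIntegrable_re_gns_mul_mul hY α W W)
    (intervalIntegrable_re_gns_mul_mul hX α W W) fun s hs => ?_
  refine mul_le_mul_of_nonneg_left ?_ (Real.exp_nonneg _)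
  have hs' : 1 - s ∈ Set.Icc (0 : ℝ) 1 := ⟨by linarith [hs.2], by linarith [hs.1]⟩
  have h1 := re_gns_mul_mul_nonneg (mpow_sub_posSemidef hX hY h hs) (mpow_posSemidef hX (1 - s)) W
  have h2 := re_gns_mul_mul_nonneg (mpow_posSemidef hY s) (mpow_sub_posSemidef hX hY h hs') W
  rw [Matrix.sub_mul, Matrix.sub_mul, gns_sub_right, Complex.sub_re] at h1
  rw [Matrix.mul_sub, gns_sub_right, Complex.sub_re] at h2
  linarith

theorem re_gns_sandwich_one_ge (α : ℝ) (W : Matrix N N ℂ) :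
    Real.exp (-|α| / 2) * (gns W W).re ≤ (gns W (sandwich 1 α W)).re := by
  rw [re_gns_sandwich Matrix.PosSemidef.one]
  have h := intervalIntegral.integral_mono_on (zero_le_one (α := ℝ))
    (f := fun _ => Real.exp (-|α| / 2) * (gns W W).re) (by simp)
    (intervalIntegrable_re_gns_mul_mul Matrix.PosSemidef.one α W W) ?_
  · simpa using h
  · intro s hs
    simp only [mpow_one_left, Matrix.one_mul, Matrix.mul_one]
    refine mul_le_mul_of_nonneg_right (Real.exp_le_exp.2 ?_) (re_gns_self_nonneg W)
    have h1 : |α * (s - 1 / 2)| ≤ |α| * (1 / 2) := by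
      rw [abs_mul]
      exact mul_le_mul_of_nonneg_left (abs_le.2 ⟨by linarith [hs.1], by linarith [hs.2]⟩)
        (abs_nonneg _)
    linarith [(abs_le.1 h1).1]

end sandwich

section transport

variable {N : Type*} [Fintype N] [DecidableEq N] {J : Type*} [Fintype J]

theorem re_gns_sandwich_ge {X : Matrix N N ℂ} (hX : X.PosSemidef) {μ : ℝ} (hμ : 0 < μ)
    (h : (X - μ • (1 : Matrix N N ℂ)).PosSemidef) (α : ℝ) (W : Matrix N N ℂ) :
    μ * (Real.exp (-|α| / 2) * (gns W W).re) ≤ (gns W (sandwich X α W)).re := by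
  refine le_trans ?_ (re_gns_sandwich_mono hX (Matrix.PosSemidef.one.smul hμ.le) h α W)
  rw [sandwich_smul_left Matrix.PosSemidef.one hμ, gns_smul_right, Complex.smul_re, smul_eq_mul]
  exact mul_le_mul_of_nonneg_left (re_gns_sandwich_one_ge α W) hμ.le

theorem two_mul_re_gns_sandwich_le {X : Matrix N N ℂ} (hX : X.PosSemidef) (α r : ℝ)
    (W Z : Matrix N N ℂ) :
    2 * r * (gns W (sandwich X α Z)).re ≤
      r ^ 2 * (gns W (sandwich X α W)).re + (gns Z (sandwich X α Z)).re := by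
  have h := re_gns_sandwich_self_nonneg hX α (r • W + (-1 : ℝ) • Z)
  simp only [sandwich_add hX, sandwich_smul_right, gns_add_left, gns_add_right, gns_smul_left,
    gns_smul_right, Complex.add_re, Complex.smul_re, smul_eq_mul,
    re_gns_sandwich_comm hX α Z W] at h
  linarith

theorem sandwich_injective [Nonempty N] {X : Matrix N N ℂ} (hX : X.PosSemidef) {μ : ℝ}
    (hμ : 0 < μ) (h : (X - μ • (1 : Matrix N N ℂ)).PosSemidef) (α : ℝ) {W : Matrix N N ℂ}
    (hW : sandwich X α W = 0) : W = 0 := by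
  apply eq_zero_of_re_gns_self
  have h1 := re_gns_sandwich_ge hX hμ h α W
  rw [hW, show gns W 0 = 0 by simp [gns, tau], Complex.zero_re, ← mul_assoc] at h1
  exact le_antisymm (nonpos_of_mul_nonpos_right h1 (by positivity)) (re_gns_self_nonneg W)

theorem sandwich_surjective [Nonempty N] {X : Matrix N N ℂ} (hX : X.PosSemidef) {μ : ℝ}
    (hμ : 0 < μ) (h : (X - μ • (1 : Matrix N N ℂ)).PosSemidef) (α : ℝ) :
    Function.Surjective (sandwich X α) := by
  let T : Matrix N N ℂ →ₗ[ℝ] Matrix N N ℂ :=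
    { toFun := sandwich X α
      map_add' := sandwich_add hX α
      map_smul' := fun r A => sandwich_smul_right X α r A }
  have hT : Function.Injective T :=
    (injective_iff_map_eq_zero T).2 fun W hW => sandwich_injective hX hμ h α hW
  exact LinearMap.injective_iff_surjective.1 hT

/-- Comparison of the transport cost at `Y` with the cost at a nearby matrix `X ≥ (1 - s²) Y`
that is bounded below by `s² c`. -/
theorem invQuadH_opOmega_le [Nonempty N] (ω : J → ℝ) {X Y : Matrix N N ℂ} (hX : X.PosSemidef)
    (hY : Y.PosSemidef) {s c κ : ℝ} (hs : s ∈ Set.Ioo (0 : ℝ) 1) (hc : 0 < c) (hκ : 0 < κ)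
    (hκω : ∀ j, κ ≤ c * Real.exp (-|ω j| / 2))
    (hXY : (X - (1 - s ^ 2) • Y).PosSemidef)
    (hX1 : (X - (s ^ 2 * c) • (1 : Matrix N N ℂ)).PosSemidef)
    (V U : J → Matrix N N ℂ) :
    invQuadH (opOmega ω X) ((1 - s ^ 2) • V + s ^ 2 • U) ≤
      ENNReal.ofReal (1 + s) * invQuadH (opOmega ω Y) V +
        ENNReal.ofReal (s * ((gnsH U U).re / κ)) := by
  obtain ⟨hs0, hs1⟩ := hs
  have hδ : 0 < s ^ 2 := by positivity
  have hδ1 : 0 < 1 - s ^ 2 := by nlinarith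
  have hex : ∃ W, opOmega ω X W = (1 - s ^ 2) • V + s ^ 2 • U ∧
      ∀ U, opOmega ω X U = 0 → gnsH W U = 0 := by
    choose W hW using fun j => sandwich_surjective hX (mul_pos hδ hc) hX1 (ω j)
      (((1 - s ^ 2) • V + s ^ 2 • U) j)
    refine ⟨W, funext hW, fun Z hZ => Finset.sum_eq_zero fun j _ => ?_⟩
    rw [sandwich_injective hX (mul_pos hδ hc) hX1 (ω j) (congrFun hZ j)]
    simp [gns, tau]
  by_cases hexY : ∃ Z, opOmega ω Y Z = V ∧ ∀ U, opOmega ω Y U = 0 → gnsH Z U = 0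
  swap
  · rw [invQuadH.eq_def (opOmega ω Y), dif_neg hexY,
      ENNReal.mul_top (by simpa using by linarith), top_add]
    exact le_top
  rw [invQuadH, dif_pos hex, invQuadH, dif_pos hexY]
  have hW := hex.choose_spec.1
  have hZ := hexY.choose_spec.1
  generalize hex.choose = W at *
  generalize hexY.choose = Z at *
  have hre (A B : J → Matrix N N ℂ) : (gnsH A B).re = ∑ j, (gns (A j) (B j)).re := by
    rw [gnsH, Complex.re_sum]
  have hUU : 0 ≤ (gnsH U U).re := by
    rw [hre]
    exact Finset.sum_nonneg fun j _ => re_gns_self_nonneg _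
  have hA : 0 ≤ (gnsH Z (opOmega ω Y Z)).re := by
    rw [hre]
    exact Finset.sum_nonneg fun j _ => re_gns_sandwich_self_nonneg hY _ _
  rw [← ENNReal.ofReal_mul (by linarith), ← ENNReal.ofReal_add (by positivity) (by positivity)]
  apply ENNReal.ofReal_le_ofReal
  have e1 : (gnsH W (opOmega ω X W)).re =
      (1 - s ^ 2) * (gnsH W (opOmega ω Y Z)).re + s ^ 2 * (gnsH W U).re := by
    rw [hW, hZ]
    simp only [hre, Finset.mul_sum, ← Finset.sum_add_distrib, Pi.add_apply, Pi.smul_apply,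
      gns_add_right, gns_smul_right, Complex.add_re, Complex.smul_re, smul_eq_mul]
  have e2 : 2 * (1 - s) * (gnsH W (opOmega ω Y Z)).re ≤
      (1 - s) ^ 2 * (gnsH W (opOmega ω Y W)).re + (gnsH Z (opOmega ω Y Z)).re := by
    simp only [hre, Finset.mul_sum, ← Finset.sum_add_distrib]
    exact Finset.sum_le_sum fun j _ => two_mul_re_gns_sandwich_le hY _ _ _ _
  have e3 : (1 - s ^ 2) * (gnsH W (opOmega ω Y W)).re ≤ (gnsH W (opOmega ω X W)).re := by
    simp only [hre, Finset.mul_sum]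
    refine Finset.sum_le_sum fun j _ => ?_
    have h := re_gns_sandwich_mono hX (hY.smul hδ1.le) hXY (ω j) (W j)
    rwa [sandwich_smul_left hY hδ1, gns_smul_right, Complex.smul_re, smul_eq_mul] at h
  have e4 : 2 * (s * κ) * (gnsH W U).re ≤ (s * κ) ^ 2 * (gnsH W W).re + (gnsH U U).re := by
    simp only [hre, Finset.mul_sum, ← Finset.sum_add_distrib]
    exact Finset.sum_le_sum fun j _ => two_mul_re_gns_le _ _ _
  have e5 : s ^ 2 * κ * (gnsH W W).re ≤ (gnsH W (opOmega ω X W)).re := by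
    simp only [hre, Finset.mul_sum]
    refine Finset.sum_le_sum fun j _ => ?_
    refine le_trans ?_ (re_gns_sandwich_ge hX (mul_pos hδ hc) hX1 (ω j) (W j))
    have := mul_le_mul_of_nonneg_left (hκω j) hδ.le
    have := mul_le_mul_of_nonneg_right this (re_gns_self_nonneg (W j))
    linarith
  generalize (gnsH W (opOmega ω X W)).re = q at *
  generalize (gnsH W (opOmega ω Y Z)).re = a at *
  generalize (gnsH W (opOmega ω Y W)).re = b at *
  generalize (gnsH Z (opOmega ω Y Z)).re = A at *
  generalize (gnsH W U).re = d at *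
  generalize (gnsH W W).re = w at *
  generalize (gnsH U U).re = u at *
  have f1 : 2 * ((1 - s ^ 2) * a) ≤ (1 - s) * q + (1 + s) * A := by
    have := mul_le_mul_of_nonneg_left e2 (by linarith : 0 ≤ 1 + s)
    have := mul_le_mul_of_nonneg_left e3 (by linarith : 0 ≤ 1 - s)
    nlinarith
  have f2 : 2 * (s ^ 2 * d) ≤ s * q + s * (u / κ) := by
    have h1 := mul_le_mul_of_nonneg_left e4 (by positivity : 0 ≤ s / κ)
    have h2 := mul_le_mul_of_nonneg_left e5 hs0.le
    have h3 : s / κ * (2 * (s * κ) * d) = 2 * (s ^ 2 * d) := by field_simp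
    have h4 : s / κ * ((s * κ) ^ 2 * w + u) = s * (s ^ 2 * κ * w) + s * (u / κ) := by field_simp
    linarith
  linarith

end transport

section divergence

variable {N : Type*} [Fintype N] {J : Type*} [Fintype J]

theorem tau_add (A B : Matrix N N ℂ) : tau (A + B) = tau A + tau B := by
  simp [tau, add_div]

theorem tau_sub (A B : Matrix N N ℂ) : tau (A - B) = tau A - tau B := by
  simp [tau, sub_div]

theorem tau_smul (r : ℝ) (A : Matrix N N ℂ) : tau (r • A) = r • tau A := by
  simp [tau, mul_div_assoc]

theorem tau_eq_zero_of_gns_one [DecidableEq N] {A : Matrix N N ℂ} (h : gns A 1 = 0) :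
    tau A = 0 := by
  rw [← star_gns, star_eq_zero] at h
  simpa [gns] using h

theorem dvg_add [Nonempty N] {Vf : J → Matrix N N ℂ}
    {dvg : (J → Matrix N N ℂ) → Matrix N N ℂ}
    (hdvg : ∀ (W : J → Matrix N N ℂ) (B : Matrix N N ℂ),
      gns (dvg W) B = -∑ j, gns (W j) (Vf j * B - B * Vf j)) (W Z : J → Matrix N N ℂ) :
    dvg (W + Z) = dvg W + dvg Z := by
  refine gns_left_ext fun B => ?_
  simp only [gns_add_left, hdvg, Pi.add_apply, Finset.sum_add_distrib, neg_add]

theorem dvg_smul [Nonempty N] {Vf : J → Matrix N N ℂ}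
    {dvg : (J → Matrix N N ℂ) → Matrix N N ℂ}
    (hdvg : ∀ (W : J → Matrix N N ℂ) (B : Matrix N N ℂ),
      gns (dvg W) B = -∑ j, gns (W j) (Vf j * B - B * Vf j)) (r : ℝ) (W : J → Matrix N N ℂ) :
    dvg (r • W) = r • dvg W := by
  refine gns_left_ext fun B => ?_
  simp only [gns_smul_left, hdvg, Pi.smul_apply, Finset.smul_sum, smul_neg]

theorem Ldag_add [Nonempty N] {L Ldag : Matrix N N ℂ → Matrix N N ℂ}
    (hLdag : ∀ ρ B : Matrix N N ℂ, gns (Ldag ρ) B = gns ρ (L B)) (A B : Matrix N N ℂ) :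
    Ldag (A + B) = Ldag A + Ldag B :=
  gns_left_ext fun C => by simp only [gns_add_left, hLdag]

theorem Ldag_smul [Nonempty N] {L Ldag : Matrix N N ℂ → Matrix N N ℂ}
    (hLdag : ∀ ρ B : Matrix N N ℂ, gns (Ldag ρ) B = gns ρ (L B)) (r : ℝ) (A : Matrix N N ℂ) :
    Ldag (r • A) = r • Ldag A :=
  gns_left_ext fun C => by simp only [gns_smul_left, hLdag]

theorem exists_dvg_eq [Nonempty N] [DecidableEq N] {Vf : J → Matrix N N ℂ} {ω : J → ℝ}
    (herg : ∀ A : Matrix N N ℂ, genL Vf ω A = 0 → ∃ c : ℂ, A = c • (1 : Matrix N N ℂ))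
    {dvg : (J → Matrix N N ℂ) → Matrix N N ℂ}
    (hdvg : ∀ (W : J → Matrix N N ℂ) (B : Matrix N N ℂ),
      gns (dvg W) B = -∑ j, gns (W j) (Vf j * B - B * Vf j))
    {B : Matrix N N ℂ} (hB : tau B = 0) : ∃ W, dvg W = B := by
  have hdtau (W : J → Matrix N N ℂ) : tau (dvg W) = 0 :=
    tau_eq_zero_of_gns_one (by rw [hdvg]; simp [gns, tau])
  have hgadd (A C : Matrix N N ℂ) : gradD Vf (A + C) = gradD Vf A + gradD Vf C := by
    funext j
    simp only [gradD, Matrix.mul_add, Matrix.add_mul, Pi.add_apply]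
    abel
  have hgsmul (r : ℝ) (A : Matrix N N ℂ) : gradD Vf (r • A) = r • gradD Vf A := by
    funext j
    simp only [gradD, Matrix.mul_smul, Matrix.smul_mul, Pi.smul_apply, smul_sub]
  let T : Matrix N N ℂ →ₗ[ℝ] Matrix N N ℂ :=
    { toFun := fun A => dvg (gradD Vf A) + tau A • (1 : Matrix N N ℂ)
      map_add' := fun A C => by
        simp only [hgadd, dvg_add hdvg, tau_add, add_smul]
        abel
      map_smul' := fun r A => by
        simp only [hgsmul, dvg_smul hdvg, tau_smul, RingHom.id_apply, smul_add, smul_assoc] }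
  have htauT (A : Matrix N N ℂ) : tau (T A) = tau A := by
    change tau (dvg (gradD Vf A) + tau A • (1 : Matrix N N ℂ)) = tau A
    rw [tau_add, hdtau, zero_add]
    simp [tau]
  have hTinj : Function.Injective T := by
    refine (injective_iff_map_eq_zero T).2 fun A hA => ?_
    have hτ : tau A = 0 := by
      rw [← htauT, hA]
      simp [tau]
    have hd : dvg (gradD Vf A) = 0 := by
      have h : dvg (gradD Vf A) + tau A • (1 : Matrix N N ℂ) = 0 := hA
      rwa [hτ, zero_smul, add_zero] at h
    have hsum : ∑ j, (gns (gradD Vf A j) (gradD Vf A j)).re = 0 := by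
      have h := hdvg (gradD Vf A) A
      rw [hd, show gns 0 A = 0 by simp [gns, tau], eq_comm, neg_eq_zero] at h
      rw [← Complex.re_sum]
      exact congrArg Complex.re h
    have hgrad (j : J) : Vf j * A - A * Vf j = 0 :=
      eq_zero_of_re_gns_self ((Finset.sum_eq_zero_iff_of_nonneg
        fun j _ => re_gns_self_nonneg _).1 hsum j (Finset.mem_univ j))
    have hL : genL Vf ω A = 0 := by
      refine Finset.sum_eq_zero fun j _ => ?_
      rw [show A * Vf j - Vf j * A = 0 by rw [← neg_sub, hgrad, neg_zero]]
      simp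
    obtain ⟨z, rfl⟩ := herg A hL
    have hz : z = 0 := by simpa [tau] using hτ
    rw [hz, zero_smul]
  obtain ⟨A, hA⟩ := LinearMap.injective_iff_surjective.1 hTinj B
  have hτ : tau A = 0 := by rw [← htauT, hA, hB]
  refine ⟨gradD Vf A, ?_⟩
  have h : dvg (gradD Vf A) + tau A • (1 : Matrix N N ℂ) = B := hA
  rwa [hτ, zero_smul, add_zero] at h

theorem exists_pos_smul_one_le [Nonempty N] [DecidableEq N] {A : Matrix N N ℂ} (hA : A.PosDef) :
    ∃ c : ℝ, 0 < c ∧ (A - c • (1 : Matrix N N ℂ)).PosSemidef := by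
  open scoped MatrixOrder in
  obtain ⟨c, hc, h⟩ := (CFC.exists_pos_algebraMap_le_iff (a := A) hA.1).2 fun x hx => by
    rw [hA.1.spectrum_real_eq_range_eigenvalues] at hx
    obtain ⟨i, rfl⟩ := hx
    exact hA.eigenvalues_pos i
  rw [Algebra.algebraMap_eq_smul_one, Matrix.le_iff] at h
  exact ⟨c, hc, h⟩

end divergence

section mixing

variable {N : Type*} [Fintype N] [DecidableEq N] {J : Type*} [Fintype J]

/-- Mixing a relaxed path with the straight line, driven by `(1 - t) U₀ + t U₁`, gives an
admissible path of positive definite matrices. -/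
theorem IsCE'.isCE_mix [Nonempty N] {Vf : J → Matrix N N ℂ} {L : Matrix N N ℂ → Matrix N N ℂ}
    {dvg : (J → Matrix N N ℂ) → Matrix N N ℂ}
    (hdvg : ∀ (W : J → Matrix N N ℂ) (B : Matrix N N ℂ),
      gns (dvg W) B = -∑ j, gns (W j) (Vf j * B - B * Vf j))
    {Ldag : Matrix N N ℂ → Matrix N N ℂ}
    (hLdag : ∀ ρ B : Matrix N N ℂ, gns (Ldag ρ) B = gns ρ (L B))
    {ε : ℝ} {ρ₀ ρ₁ : Matrix N N ℂ} (h₀ : ρ₀.PosDef) (h₀tr : tau ρ₀ = 1) (h₁ : ρ₁.PosDef)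
    (h₁tr : tau ρ₁ = 1) {U₀ U₁ : J → Matrix N N ℂ} (hU₀ : dvg U₀ = ε • Ldag ρ₀ - (ρ₁ - ρ₀))
    (hU₁ : dvg U₁ = ε • Ldag ρ₁ - (ρ₁ - ρ₀)) {ρ : ℝ → Matrix N N ℂ} {Vc : ℝ → J → Matrix N N ℂ}
    (h : IsCE' dvg Ldag ε ρ₀ ρ₁ ρ Vc) {δ : ℝ} (hδ : δ ∈ Set.Ioo (0 : ℝ) 1) :
    IsCE dvg Ldag ε ρ₀ ρ₁ (fun t => (1 - δ) • ρ t + δ • ((1 - t) • ρ₀ + t • ρ₁))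
      (fun t => (1 - δ) • Vc t + δ • ((1 - t) • U₀ + t • U₁)) := by
  obtain ⟨hρ0, hρ1, hρ, hV, ρ', hd, hc, hce⟩ := h
  obtain ⟨hδ0, hδ1⟩ := hδ
  refine ⟨?_, ?_, fun t ht => ⟨?_, ?_⟩, fun j i k => ?_,
    fun t => (1 - δ) • ρ' t + δ • (ρ₁ - ρ₀), fun t ht i k => ?_, fun i k => ?_, fun t ht => ?_⟩
  · simp only [hρ0, sub_zero, one_smul, zero_smul, add_zero, ← add_smul, sub_add_cancel]
  · simp only [hρ1, sub_self, one_smul, zero_smul, zero_add, ← add_smul, sub_add_cancel]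
  · refine Matrix.PosDef.posSemidef_add ((hρ t ht).1.smul (by linarith)) (Matrix.PosDef.smul ?_ hδ0)
    rcases ht.1.eq_or_lt with rfl | ht0
    · simpa using h₀
    · exact Matrix.PosDef.posSemidef_add (h₀.posSemidef.smul (by linarith [ht.2])) (h₁.smul ht0)
  · simp only [tau_add, tau_smul, (hρ t ht).2, h₀tr, h₁tr, ← add_smul]
    simp
  · have := hV j i k
    simp only [Pi.add_apply, Pi.smul_apply, Matrix.add_apply, Matrix.smul_apply]
    fun_prop
  · simp only [Matrix.add_apply, Matrix.smul_apply, Matrix.sub_apply]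
    refine ((hd t ht i k).const_smul (1 - δ)).add (HasDerivAt.const_smul δ ?_)
    have h1 : HasDerivAt (fun s : ℝ => (1 - s) • ρ₀ i k) ((-1 : ℝ) • ρ₀ i k) t :=
      ((hasDerivAt_id t).const_sub 1).smul_const _
    have h2 : HasDerivAt (fun s : ℝ => s • ρ₁ i k) ((1 : ℝ) • ρ₁ i k) t :=
      (hasDerivAt_id t).smul_const _
    exact (h1.add h2).congr_deriv (by module)
  · have := hc i k
    simp only [Matrix.add_apply, Matrix.smul_apply]
    fun_prop
  · simp only [dvg_add hdvg, dvg_smul hdvg, Ldag_add hLdag, Ldag_smul hLdag, hU₀, hU₁]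
    rw [eq_sub_of_add_eq' (hce t ht)]
    module

end mixing

/-- **Relaxation of the transport problem** (Proposition 1.2): relaxing the invertibility
constraint on the connecting curve does not change the transport distance,
`W_ε²(ρ₀,ρ₁) = inf { ∫₀¹ ⟨V(t), [ρ(t)]_ω⁻¹ V(t)⟩ dt : (ρ,V) ∈ CE'_ε(ρ₀,ρ₁) }`. -/
theorem relaxed_paths_CE
    {N : Type*} [Fintype N] [DecidableEq N] {J : Type*} [Fintype J]
    (ε : ℝ) (hε : 0 ≤ ε)
    (st : J → J) (Vf : J → Matrix N N ℂ) (ω : J → ℝ)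
    (hON : ∀ j k, tau ((Vf j)ᴴ * Vf k) = if j = k then 1 else 0)
    (htr : ∀ j, tau (Vf j) = 0)
    (hstinv : ∀ j, st (st j) = j)
    (hVst : ∀ j, Vf (st j) = (Vf j)ᴴ)
    (hωst : ∀ j, ω (st j) = -ω j)
    (σ : Matrix N N ℂ) (hσ : σ.PosDef) (hσtr : tau σ = 1)
    (hDBC : ∀ j, σ * Vf j = Real.exp (-ω j) • (Vf j * σ))
    (herg : ∀ A : Matrix N N ℂ, genL Vf ω A = 0 → ∃ c : ℂ, A = c • (1 : Matrix N N ℂ))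
    (dvg : (J → Matrix N N ℂ) → Matrix N N ℂ)
    (hdvg : ∀ (W : J → Matrix N N ℂ) (B : Matrix N N ℂ),
      gns (dvg W) B = -∑ j, gns (W j) (Vf j * B - B * Vf j))
    (Ldag : Matrix N N ℂ → Matrix N N ℂ)
    (hLdag : ∀ ρ B : Matrix N N ℂ, gns (Ldag ρ) B = gns ρ (genL Vf ω B))
    (ρ₀ ρ₁ : Matrix N N ℂ)
    (h₀ : ρ₀.PosDef) (h₀tr : tau ρ₀ = 1) (h₁ : ρ₁.PosDef) (h₁tr : tau ρ₁ = 1) :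
    Wsq ω dvg Ldag ε ρ₀ ρ₁ =
      ⨅ (ρ : ℝ → Matrix N N ℂ) (Vc : ℝ → J → Matrix N N ℂ)
        (_ : IsCE' dvg Ldag ε ρ₀ ρ₁ ρ Vc),
          ∫⁻ t in Set.Icc (0:ℝ) 1, invQuadH (opOmega ω (ρ t)) (Vc t) := by
  have hN : Nonempty N := by
    by_contra hN
    rw [not_nonempty_iff] at hN
    simp [tau] at hσtr
  have hLtau (ρ : Matrix N N ℂ) : tau (Ldag ρ) = 0 := by
    apply tau_eq_zero_of_gns_one
    rw [hLdag]
    simp [genL, gns, tau]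
  have hB (ρ : Matrix N N ℂ) : tau (ε • Ldag ρ - (ρ₁ - ρ₀)) = 0 := by
    rw [tau_sub, tau_sub, tau_smul, hLtau, h₀tr, h₁tr]
    simp
  obtain ⟨U₀, hU₀⟩ := exists_dvg_eq herg hdvg (hB ρ₀)
  obtain ⟨U₁, hU₁⟩ := exists_dvg_eq herg hdvg (hB ρ₁)
  obtain ⟨c, hc, hc₀, hc₁⟩ : ∃ c : ℝ, 0 < c ∧ (ρ₀ - c • (1 : Matrix N N ℂ)).PosSemidef ∧
      (ρ₁ - c • (1 : Matrix N N ℂ)).PosSemidef := by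
    obtain ⟨a, ha, ha'⟩ := exists_pos_smul_one_le h₀
    obtain ⟨b, hb, hb'⟩ := exists_pos_smul_one_le h₁
    refine ⟨min a b, lt_min ha hb, ?_, ?_⟩
    · convert ha'.add (Matrix.PosSemidef.one.smul (sub_nonneg.2 (min_le_left a b))) using 1
      module
    · convert hb'.add (Matrix.PosSemidef.one.smul (sub_nonneg.2 (min_le_right a b))) using 1
      module
  obtain ⟨κ, hκ, hκω⟩ : ∃ κ : ℝ, 0 < κ ∧ ∀ j, κ ≤ c * Real.exp (-|ω j| / 2) := by
    refine ⟨c * Real.exp (-(∑ j, |ω j|) / 2), by positivity, fun j => ?_⟩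
    have := Finset.single_le_sum (f := fun j => |ω j|) (fun j _ => abs_nonneg _)
      (Finset.mem_univ j)
    gcongr
  obtain ⟨C, hC⟩ := isCompact_Icc.exists_bound_of_continuousOn (s := Set.Icc (0 : ℝ) 1)
    (f := fun t : ℝ => (gnsH ((1 - t) • U₀ + t • U₁) ((1 - t) • U₀ + t • U₁)).re) (by
      simp only [gnsH, Complex.re_sum, Pi.add_apply, Pi.smul_apply, gns_add_left, gns_add_right,
        gns_smul_left, gns_smul_right, Complex.add_re, Complex.smul_re]
      fun_prop)
  have hcost {ρ : ℝ → Matrix N N ℂ} {Vc : ℝ → J → Matrix N N ℂ}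
      (h : IsCE' dvg Ldag ε ρ₀ ρ₁ ρ Vc) {s : ℝ} (hs : s ∈ Set.Ioo (0 : ℝ) 1) :
      Wsq ω dvg Ldag ε ρ₀ ρ₁ ≤ ENNReal.ofReal (1 + s) *
        (∫⁻ t in Set.Icc (0 : ℝ) 1, invQuadH (opOmega ω (ρ t)) (Vc t)) +
          ENNReal.ofReal (s * (C / κ)) := by
    have hs2 : s ^ 2 ∈ Set.Ioo (0 : ℝ) 1 := ⟨by have := hs.1; positivity, by nlinarith [hs.1, hs.2]⟩
    have hmix := h.isCE_mix hdvg hLdag h₀ h₀tr h₁ h₁tr hU₀ hU₁ hs2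
    refine iInf_le_of_le _ (iInf_le_of_le _ (iInf_le_of_le hmix ?_))
    have hintegral : ∫⁻ t in Set.Icc (0 : ℝ) 1, (ENNReal.ofReal (1 + s) *
        invQuadH (opOmega ω (ρ t)) (Vc t) + ENNReal.ofReal (s * (C / κ))) =
        ENNReal.ofReal (1 + s) * (∫⁻ t in Set.Icc (0 : ℝ) 1, invQuadH (opOmega ω (ρ t)) (Vc t)) +
          ENNReal.ofReal (s * (C / κ)) := by
      rw [lintegral_add_right _ measurable_const, lintegral_const_mul' _ _ ENNReal.ofReal_ne_top]
      simp
    rw [← hintegral]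
    refine setLIntegral_mono' measurableSet_Icc fun t ht => ?_
    have hρt := (h.2.2.1 t ht).1
    have hline : ((1 - t) • ρ₀ + t • ρ₁).PosSemidef :=
      (h₀.posSemidef.smul (by linarith [ht.2])).add (h₁.posSemidef.smul ht.1)
    refine (invQuadH_opOmega_le ω (hmix.2.2.1 t ht).1.posSemidef hρt hs hc hκ hκω ?_ ?_ _ _).trans ?_
    · rw [add_sub_cancel_left]
      exact hline.smul hs2.1.le
    · convert (hρt.smul (by linarith [hs2.2] : 0 ≤ 1 - s ^ 2)).add
        (((hc₀.smul (by linarith [ht.2] : 0 ≤ 1 - t)).add (hc₁.smul ht.1)).smul hs2.1.le) using 1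
      module
    · have := hs.1.le
      have := (le_abs_self _).trans (hC t ht)
      gcongr
  apply le_antisymm
  · refine le_iInf fun ρ => le_iInf fun Vc => le_iInf fun h => ?_
    have hlim : Filter.Tendsto (fun s : ℝ => ENNReal.ofReal (1 + s) *
        (∫⁻ t in Set.Icc (0 : ℝ) 1, invQuadH (opOmega ω (ρ t)) (Vc t)) +
          ENNReal.ofReal (s * (C / κ))) (nhdsWithin 0 (Set.Ioi 0))
        (nhds (ENNReal.ofReal (1 + 0) *
          (∫⁻ t in Set.Icc (0 : ℝ) 1, invQuadH (opOmega ω (ρ t)) (Vc t)) +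
            ENNReal.ofReal (0 * (C / κ)))) := by
      refine Filter.Tendsto.mono_left ?_ nhdsWithin_le_nhds
      refine (ENNReal.Tendsto.mul_const (ENNReal.tendsto_ofReal ?_) (Or.inl (by simp))).add
        (ENNReal.tendsto_ofReal ?_)
      · exact Continuous.tendsto (by fun_prop) 0
      · exact Continuous.tendsto (by fun_prop) 0
    rw [add_zero, ENNReal.ofReal_one, one_mul, zero_mul, ENNReal.ofReal_zero, add_zero] at hlim
    refine ge_of_tendsto hlim ?_
    filter_upwards [Ioo_mem_nhdsGT (zero_lt_one (α := ℝ))] with s hs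
    exact hcost h hs
  · refine le_iInf fun ρ => le_iInf fun Vc => le_iInf fun h => ?_
    refine iInf_le_of_le ρ (iInf_le_of_le Vc (iInf_le_of_le ?_ le_rfl))
    exact ⟨h.1, h.2.1, fun t ht => ⟨(h.2.2.1 t ht).1.posSemidef, (h.2.2.1 t ht).2⟩, h.2.2.2⟩
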